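/- arXiv:2411.15401 — 2 statements merged into one kernel-verified Lean document; each statement's English description precedes it below -/
import Mathlib

section
/- Let a < b be real numbers and n ≥ 1 an integer. For X, Y ∈ 𝒳_{[a,b]}, X dominates Y in nth-order stochastic dominance on [a,b] (X ≥ₙ^{[a,b]} Y) if and only if E[u(X)] ≥ E[u(Y)] for every u ∈ 𝒰ₙ^{[a,b]}. -/
open MeasureTheory Filter Set

/-- `E[(η−x)₊^{n−1}]`-integrand: for `n = 1` the indicator of `x ≤ η`,
for `n ≥ 2` the positive part `(η−x)₊` raised to `n−1`. -/
noncomputable def momFn (n : ℕ) (η x : ℝ) : ℝ :=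
  if n = 1 then (if x ≤ η then (1 : ℝ) else 0) else (max (η - x) 0) ^ (n - 1)

/-- `n`th-order stochastic dominance on ℝ: `X ≥ₙ Y`. -/
def SD {Ω : Type*} [MeasurableSpace Ω] (μ : Measure Ω) (X Y : Ω → ℝ) (n : ℕ) : Prop :=
  ∀ η : ℝ, (∫ ω, momFn n η (X ω) ∂μ) ≤ ∫ ω, momFn n η (Y ω) ∂μ

/-- `n`th-order stochastic dominance on `[a, r]`: `X ≥ₙ^{[a,r]} Y`. -/
def SDI {Ω : Type*} [MeasurableSpace Ω] (μ : Measure Ω) (X Y : Ω → ℝ)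
    (n : ℕ) (a r : ℝ) : Prop :=
  (∀ η ∈ Set.Icc a r, (∫ ω, momFn n η (X ω) ∂μ) ≤ ∫ ω, momFn n η (Y ω) ∂μ) ∧
  ∀ k ∈ Finset.Icc 1 n, (∫ ω, (r - X ω) ^ (k - 1) ∂μ) ≤ ∫ ω, (r - Y ω) ^ (k - 1) ∂μ

/-- The class of `n`-times differentiable utilities `u` with
`(-1)^(k-1) * u^(k) ≥ 0` on `s` for all `k ∈ {1,…,n}`. -/
def UClass (n : ℕ) (s : Set ℝ) (u : ℝ → ℝ) : Prop :=
  (∀ k < n, Differentiable ℝ (iteratedDeriv k u)) ∧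
  ∀ k ∈ Finset.Icc 1 n, ∀ x ∈ s, 0 ≤ (-1 : ℝ) ^ (k - 1) * iteratedDeriv k u x

/-! ### The kernel `momFn` -/

lemma momFn_eq_sub (n : ℕ) (η x : ℝ) : momFn n η x = momFn n (η - x) 0 := by
  simp [momFn]

lemma momFn_nonneg (n : ℕ) (η x : ℝ) : 0 ≤ momFn n η x := by
  unfold momFn
  split_ifs <;> positivity

lemma momFn_of_le {n : ℕ} {η x : ℝ} (h : x ≤ η) : momFn n η x = (η - x) ^ (n - 1) := by
  unfold momFn
  split_ifs with hn
  · simp [hn]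
  · rw [max_eq_left (sub_nonneg.2 h)]

lemma momFn_of_lt {n : ℕ} (hn : 1 ≤ n) {η x : ℝ} (h : η < x) : momFn n η x = 0 := by
  unfold momFn
  split_ifs with h1 h2
  · linarith
  · rfl
  · rw [max_eq_right (by linarith), zero_pow (by omega)]

lemma momFn_mono {n : ℕ} (hn : 1 ≤ n) {η η' : ℝ} (h : η ≤ η') (x : ℝ) :
    momFn n η x ≤ momFn n η' x := by
  rcases lt_or_ge η x with hx | hx
  · rw [momFn_of_lt hn hx]
    exact momFn_nonneg ..
  · rw [momFn_of_le hx, momFn_of_le (hx.trans h)]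
    exact pow_le_pow_left₀ (by linarith) (by linarith) _

lemma momFn_le_pow {n : ℕ} (hn : 1 ≤ n) {η x c : ℝ} (hc : 0 ≤ c) (h : η - x ≤ c) :
    momFn n η x ≤ c ^ (n - 1) := by
  rw [momFn_eq_sub]
  refine (momFn_mono hn h 0).trans ?_
  rw [momFn_of_le hc, sub_zero]

lemma measurable_momFn_uncurry (n : ℕ) : Measurable fun p : ℝ × ℝ => momFn n p.1 p.2 := by
  unfold momFn
  split_ifs
  · exact Measurable.ite (measurableSet_le measurable_snd measurable_fst)
      measurable_const measurable_const
  · fun_prop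

lemma measurable_momFn (n : ℕ) (η : ℝ) : Measurable (momFn n η) :=
  (measurable_momFn_uncurry n).comp measurable_prodMk_left

lemma tendsto_momFn {n : ℕ} (hn : 1 ≤ n) (η x : ℝ) {h : ℕ → ℝ} (hpos : ∀ j, 0 ≤ h j)
    (hlim : Tendsto h atTop (nhds 0)) :
    Tendsto (fun j => momFn n (η + h j) x) atTop (nhds (momFn n η x)) := by
  have hη : Tendsto (fun j => η + h j) atTop (nhds η) := by
    simpa using hlim.const_add η
  rcases lt_or_ge η x with hx | hx
  · rw [momFn_of_lt hn hx]
    refine tendsto_const_nhds.congr' ?_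
    filter_upwards [hη.eventually_lt_const hx] with j hj
    rw [momFn_of_lt hn hj]
  · rw [momFn_of_le hx]
    refine ((hη.sub_const x).pow (n - 1)).congr fun j => ?_
    rw [momFn_of_le (by linarith [hpos j])]

/-! ### Powers of the positive part -/

lemma mul_pow_le_pow_succ_sub {p q : ℝ} (hp : 0 ≤ p) (hpq : p ≤ q) (m : ℕ) :
    (m + 1) * (q - p) * p ^ m ≤ q ^ (m + 1) - p ^ (m + 1) := by
  induction m with
  | zero => simp
  | succ m ih =>
    have h1 : p ^ (m + 1) ≤ q ^ (m + 1) := pow_le_pow_left₀ hp hpq _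
    have h2 := mul_le_mul_of_nonneg_left ih hp
    have h3 := mul_le_mul_of_nonneg_left h1 (sub_nonneg.2 hpq)
    push_cast
    linear_combination h2 + h3

lemma pow_succ_sub_le_mul_pow {p q : ℝ} (hp : 0 ≤ p) (hpq : p ≤ q) (m : ℕ) :
    q ^ (m + 1) - p ^ (m + 1) ≤ (m + 1) * (q - p) * q ^ m := by
  induction m with
  | zero => simp
  | succ m ih =>
    have h1 : p ^ (m + 1) ≤ q ^ (m + 1) := pow_le_pow_left₀ hp hpq _
    have h2 := mul_le_mul_of_nonneg_left ih (hp.trans hpq)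
    have h3 := mul_le_mul_of_nonneg_left h1 (sub_nonneg.2 hpq)
    push_cast
    linear_combination h2 + h3

lemma mul_momFn_le_posPart_pow_sub {p q : ℝ} (hpq : p ≤ q) (m : ℕ) :
    (m + 1) * (q - p) * momFn (m + 1) p 0 ≤ max q 0 ^ (m + 1) - max p 0 ^ (m + 1) := by
  rcases lt_or_ge p 0 with hp | hp
  · rw [momFn_of_lt (by omega) hp, max_eq_right hp.le]
    simp only [mul_zero, zero_pow (Nat.succ_ne_zero m), sub_zero]
    positivity
  · rw [momFn_of_le hp, max_eq_left hp, max_eq_left (hp.trans hpq)]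
    simpa using mul_pow_le_pow_succ_sub hp hpq m

lemma posPart_pow_sub_le_mul_momFn {p q : ℝ} (hpq : p ≤ q) (m : ℕ) :
    max q 0 ^ (m + 1) - max p 0 ^ (m + 1) ≤ (m + 1) * (q - p) * momFn (m + 1) q 0 := by
  rcases lt_or_ge q 0 with hq | hq
  · rw [momFn_of_lt (by omega) hq, max_eq_right hq.le, max_eq_right (hpq.trans hq.le)]
    simp
  · have h := pow_succ_sub_le_mul_pow (le_max_right p 0) (max_le hpq hq) m
    rw [momFn_of_le hq, max_eq_left hq]
    refine h.trans ?_
    simp only [sub_zero, Nat.add_sub_cancel]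
    gcongr
    exact le_max_left p 0

lemma hasDerivAt_posPart_pow (m : ℕ) (y : ℝ) :
    HasDerivAt (fun y : ℝ => max y 0 ^ (m + 2)) ((m + 2) * max y 0 ^ (m + 1)) y := by
  refine hasDerivAt_of_hasDerivAt_of_ne' (x := 0)
    (g := fun y : ℝ => ((m : ℝ) + 2) * max y 0 ^ (m + 1)) (fun z hz => ?_)
    (by fun_prop) (by fun_prop) y
  rcases lt_or_gt_of_ne hz with hz | hz
  · simp only [max_eq_right hz.le, zero_pow (Nat.succ_ne_zero m), mul_zero]
    refine (hasDerivAt_const z (0 : ℝ)).congr_of_eventuallyEq ?_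
    filter_upwards [eventually_lt_nhds hz] with w hw
    rw [max_eq_right hw.le, zero_pow (by omega)]
  · simp only [max_eq_left hz.le]
    have h := hasDerivAt_pow (m + 2) z
    push_cast at h
    refine h.congr_of_eventuallyEq ?_
    filter_upwards [eventually_gt_nhds hz] with w hw
    rw [max_eq_left hw.le]

/-- The second forward difference with step `h` of the `N`-th power of the positive part. -/
noncomputable def posPartSecondDiff (N : ℕ) (h y : ℝ) : ℝ :=
  max (y + 2 * h) 0 ^ N - 2 * max (y + h) 0 ^ N + max y 0 ^ N

lemma posPartSecondDiff_nonneg (m : ℕ) {h : ℝ} (hh : 0 ≤ h) (y : ℝ) :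
    0 ≤ posPartSecondDiff (m + 1) h y := by
  have h1 := mul_momFn_le_posPart_pow_sub (show y + h ≤ y + 2 * h by linarith) m
  have h2 := posPart_pow_sub_le_mul_momFn (show y ≤ y + h by linarith) m
  unfold posPartSecondDiff
  linear_combination h1 + h2

lemma hasDerivAt_posPartSecondDiff (m : ℕ) (h y : ℝ) :
    HasDerivAt (posPartSecondDiff (m + 2) h) ((m + 2) * posPartSecondDiff (m + 1) h y) y := by
  have h1 := (hasDerivAt_posPart_pow m (y + 2 * h)).comp_add_const y (2 * h)
  have h2 := ((hasDerivAt_posPart_pow m (y + h)).comp_add_const y h).const_mul 2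
  refine ((h1.sub h2).add (hasDerivAt_posPart_pow m y)).congr_deriv ?_
  unfold posPartSecondDiff
  ring

lemma continuous_posPartSecondDiff (N : ℕ) (h : ℝ) : Continuous (posPartSecondDiff N h) := by
  unfold posPartSecondDiff
  fun_prop

lemma exists_posPartSecondDiff_eq (m : ℕ) {h : ℝ} (hh : 0 < h) (y : ℝ) :
    ∃ z ∈ Ioo y (y + h), posPartSecondDiff (m + 2) h y =
      (m + 2) * h * (max (z + h) 0 ^ (m + 1) - max z 0 ^ (m + 1)) := by
  have hd : ∀ z, HasDerivAt (fun z : ℝ => max (z + h) 0 ^ (m + 2) - max z 0 ^ (m + 2))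
      ((m + 2) * max (z + h) 0 ^ (m + 1) - (m + 2) * max z 0 ^ (m + 1)) z := fun z =>
    ((hasDerivAt_posPart_pow m (z + h)).comp_add_const z h).sub (hasDerivAt_posPart_pow m z)
  obtain ⟨z, hz, hzeq⟩ := exists_hasDerivAt_eq_slope _ _ (show y < y + h by linarith)
    (fun z _ => (hd z).continuousAt.continuousWithinAt) (fun z _ => hd z)
  refine ⟨z, hz, ?_⟩
  rw [eq_div_iff (by linarith)] at hzeq
  have e : y + h + h = y + 2 * h := by ring
  rw [e] at hzeq
  unfold posPartSecondDiff
  linear_combination -hzeq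

lemma mul_momFn_le_posPartSecondDiff (m : ℕ) {h : ℝ} (hh : 0 < h) (y : ℝ) :
    (m + 2) * (m + 1) * h ^ 2 * momFn (m + 1) y 0 ≤ posPartSecondDiff (m + 2) h y := by
  obtain ⟨z, hz, hzeq⟩ := exists_posPartSecondDiff_eq m hh y
  have h1 := mul_momFn_le_posPart_pow_sub (show z ≤ z + h by linarith) m
  have h2 := momFn_mono (show 1 ≤ m + 1 by omega) hz.1.le 0
  calc (m + 2) * (m + 1) * h ^ 2 * momFn (m + 1) y 0
      ≤ (m + 2) * (m + 1) * h ^ 2 * momFn (m + 1) z 0 := by gcongr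
    _ = (m + 2) * h * ((m + 1) * (z + h - z) * momFn (m + 1) z 0) := by ring
    _ ≤ (m + 2) * h * (max (z + h) 0 ^ (m + 1) - max z 0 ^ (m + 1)) := by gcongr
    _ = _ := hzeq.symm

lemma posPartSecondDiff_le_mul_momFn (m : ℕ) {h : ℝ} (hh : 0 < h) (y : ℝ) :
    posPartSecondDiff (m + 2) h y ≤ (m + 2) * (m + 1) * h ^ 2 * momFn (m + 1) (y + 2 * h) 0 := by
  obtain ⟨z, hz, hzeq⟩ := exists_posPartSecondDiff_eq m hh y
  have h1 := posPart_pow_sub_le_mul_momFn (show z ≤ z + h by linarith) m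
  have h2 := momFn_mono (show 1 ≤ m + 1 by omega) (show z + h ≤ y + 2 * h by linarith [hz.2]) 0
  calc posPartSecondDiff (m + 2) h y
      = (m + 2) * h * (max (z + h) 0 ^ (m + 1) - max z 0 ^ (m + 1)) := hzeq
    _ ≤ (m + 2) * h * ((m + 1) * (z + h - z) * momFn (m + 1) (z + h) 0) := by gcongr
    _ = (m + 2) * (m + 1) * h ^ 2 * momFn (m + 1) (z + h) 0 := by ring
    _ ≤ (m + 2) * (m + 1) * h ^ 2 * momFn (m + 1) (y + 2 * h) 0 := by gcongr

/-! ### Membership in `UClass` -/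

lemma iteratedDeriv_eq_of_hasDerivAt {n : ℕ} {F : ℕ → ℝ → ℝ}
    (hF : ∀ k < n, ∀ x, HasDerivAt (F k) (F (k + 1) x) x) {k : ℕ} (hk : k ≤ n) :
    iteratedDeriv k (F 0) = F k := by
  induction k with
  | zero => exact iteratedDeriv_zero
  | succ k ih =>
    rw [iteratedDeriv_succ, ih (by omega)]
    exact funext fun x => (hF k (by omega) x).deriv

lemma uClass_of_hasDerivAt {n : ℕ} {s : Set ℝ} {F : ℕ → ℝ → ℝ}
    (hF : ∀ k < n, ∀ x, HasDerivAt (F k) (F (k + 1) x) x)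
    (hs : ∀ k ∈ Finset.Icc 1 n, ∀ x ∈ s, 0 ≤ (-1 : ℝ) ^ (k - 1) * F k x) :
    UClass n s (F 0) := by
  refine ⟨fun k hk => ?_, fun k hk x hx => ?_⟩
  · rw [iteratedDeriv_eq_of_hasDerivAt hF hk.le]
    exact fun x => (hF k hk x).differentiableAt
  · rw [iteratedDeriv_eq_of_hasDerivAt hF (Finset.mem_Icc.1 hk).2]
    exact hs k hk x hx

lemma neg_one_pow_pred_mul_nonneg {k : ℕ} (hk : 1 ≤ k) {c : ℝ} (hc : 0 ≤ c) :
    0 ≤ (-1 : ℝ) ^ (k - 1) * ((-1) ^ (k + 1) * c) := by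
  obtain ⟨k, rfl⟩ := Nat.exists_eq_add_of_le' hk
  rw [← mul_assoc, ← pow_add, Even.neg_one_pow ⟨k + 1, by omega⟩, one_mul]
  exact hc

lemma uClass_neg_pow (n m : ℕ) (a b : ℝ) : UClass n (Icc a b) fun x => -(b - x) ^ m := by
  have h := uClass_of_hasDerivAt (n := n) (s := Icc a b)
    (F := fun k x => (-1) ^ (k + 1) * ((m.descFactorial k : ℝ) * (b - x) ^ (m - k)))
    (fun k _ x => ?_) (fun k hk x hx => ?_)
  · simpa using h
  · have h := (((hasDerivAt_id x).const_sub b).pow (m - k)).const_mul (m.descFactorial k : ℝ)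
    refine (h.const_mul ((-1 : ℝ) ^ (k + 1))).congr_deriv ?_
    rw [Nat.descFactorial_succ, Nat.sub_sub]
    push_cast
    simp only [id]
    ring
  · have : 0 ≤ b - x := sub_nonneg.2 hx.2
    exact neg_one_pow_pred_mul_nonneg (Finset.mem_Icc.1 hk).1 (by positivity)

lemma uClass_neg_posPartSecondDiff (m : ℕ) (s : Set ℝ) {h : ℝ} (hh : 0 ≤ h) (η : ℝ) :
    UClass (m + 1) s fun x => -posPartSecondDiff (m + 2) h (η - x) := by
  have h := uClass_of_hasDerivAt (n := m + 1) (s := s)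
    (F := fun k x => (-1) ^ (k + 1) *
      (((m + 2).descFactorial k : ℝ) * posPartSecondDiff (m + 2 - k) h (η - x)))
    (fun k hk x => ?_) (fun k hk x _ => ?_)
  · simpa using h
  · obtain ⟨j, rfl⟩ := Nat.exists_eq_add_of_le (Nat.lt_succ_iff.1 hk)
    have e1 : k + j + 2 - k = j + 2 := by omega
    have e2 : k + j + 2 - (k + 1) = j + 1 := by omega
    have h := ((hasDerivAt_posPartSecondDiff j h (η - x)).comp x
      ((hasDerivAt_id x).const_sub η)).const_mul ((k + j + 2).descFactorial k : ℝ)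
    rw [Nat.descFactorial_succ, e1, e2]
    refine (h.const_mul ((-1 : ℝ) ^ (k + 1))).congr_deriv ?_
    push_cast
    ring
  · obtain ⟨hk1, hk2⟩ := Finset.mem_Icc.1 hk
    have e : m + 2 - k = (m + 1 - k) + 1 := by omega
    have := posPartSecondDiff_nonneg (m + 1 - k) hh (η - x)
    refine neg_one_pow_pred_mul_nonneg hk1 ?_
    rw [e]
    positivity

/-! ### Integrability of functions of a bounded random variable -/

section Integrability

variable {Ω : Type*} [MeasurableSpace Ω] {μ : Measure Ω} [IsProbabilityMeasure μ]
  {a b : ℝ} {X : Ω → ℝ}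

lemma integrable_comp_of_mem_Icc (hX : Measurable X) (hXab : ∀ ω, X ω ∈ Icc a b)
    {f : ℝ → ℝ} (hf : Continuous f) : Integrable (fun ω => f (X ω)) μ := by
  obtain ⟨C, hC⟩ := isCompact_Icc.exists_bound_of_continuousOn (s := Icc a b) hf.continuousOn
  exact .of_bound (hf.measurable.comp hX).aestronglyMeasurable C
    (Eventually.of_forall fun ω => hC _ (hXab ω))

lemma norm_momFn_le {n : ℕ} (hn : 1 ≤ n) {η c x : ℝ} (hx : a ≤ x) (hc : 0 ≤ c)
    (h : η - a ≤ c) : ‖momFn n η x‖ ≤ c ^ (n - 1) := by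
  rw [Real.norm_of_nonneg (momFn_nonneg ..)]
  exact momFn_le_pow hn hc (by linarith)

lemma integrable_momFn_comp {n : ℕ} (hn : 1 ≤ n) (hX : Measurable X)
    (hXa : ∀ ω, a ≤ X ω) (η : ℝ) : Integrable (fun ω => momFn n η (X ω)) μ :=
  .of_bound ((measurable_momFn n η).comp hX).aestronglyMeasurable (|η - a| ^ (n - 1))
    (Eventually.of_forall fun ω => norm_momFn_le hn (hXa ω) (abs_nonneg _) (le_abs_self _))

lemma tendsto_integral_momFn {n : ℕ} (hn : 1 ≤ n) (hX : Measurable X)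
    (hXa : ∀ ω, a ≤ X ω) (η : ℝ) {h : ℕ → ℝ} (hpos : ∀ j, 0 ≤ h j) {c : ℝ}
    (hle : ∀ j, h j ≤ c) (hlim : Tendsto h atTop (nhds 0)) :
    Tendsto (fun j => ∫ ω, momFn n (η + h j) (X ω) ∂μ) atTop
      (nhds (∫ ω, momFn n η (X ω) ∂μ)) := by
  refine tendsto_integral_of_dominated_convergence (fun _ => |η + c - a| ^ (n - 1))
    (fun j => ((measurable_momFn n _).comp hX).aestronglyMeasurable) (integrable_const _)
    (fun j => Eventually.of_forall fun ω => norm_momFn_le hn (hXa ω) (abs_nonneg _) ?_)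
    (Eventually.of_forall fun ω => tendsto_momFn hn η (X ω) hpos hlim)
  exact le_trans (by linarith [hle j]) (le_abs_self _)

end Integrability

/-! ### Taylor expansion at the right endpoint -/

lemma hasDerivAt_taylor_sum {u : ℝ → ℝ} {m : ℕ}
    (hu : ∀ k < m + 1, Differentiable ℝ (iteratedDeriv k u)) (x t : ℝ) :
    HasDerivAt (fun t => ∑ k ∈ Finset.range (m + 1),
        iteratedDeriv k u t / (k.factorial : ℝ) * (x - t) ^ k)
      (iteratedDeriv (m + 1) u t / (m.factorial : ℝ) * (x - t) ^ m) t := by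
  have hd : ∀ k < m + 1, HasDerivAt (iteratedDeriv k u) (iteratedDeriv (k + 1) u t) t :=
    fun k hk => by
      rw [iteratedDeriv_succ]
      exact (hu k hk t).hasDerivAt
  induction m with
  | zero => simpa using! hd 0 (by omega)
  | succ m ih =>
    simp_rw [Finset.sum_range_succ _ (m + 1)]
    have h1 := ih (fun k hk => hu k (by omega)) fun k hk => hd k (by omega)
    have h2 := ((hd (m + 1) (by omega)).div_const ((m + 1).factorial : ℝ)).mul
      (((hasDerivAt_id t).const_sub x).pow (m + 1))
    refine (h1.add h2).congr_deriv ?_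
    have : (m.factorial : ℝ) ≠ 0 := by positivity
    rw [Nat.factorial_succ]
    push_cast
    simp only [id, Pi.pow_apply]
    field_simp
    ring

section Taylor

variable {u : ℝ → ℝ} {m : ℕ} {a b : ℝ}

lemma UClass.hasDerivAt (hu : UClass (m + 1) (Icc a b) u) (t : ℝ) :
    HasDerivAt (iteratedDeriv m u) (iteratedDeriv (m + 1) u t) t := by
  rw [iteratedDeriv_succ]
  exact (hu.1 m (by omega) t).hasDerivAt

lemma UClass.nonneg (hu : UClass (m + 1) (Icc a b) u) {t : ℝ} (ht : t ∈ Icc a b) :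
    0 ≤ (-1 : ℝ) ^ m * iteratedDeriv (m + 1) u t :=
  hu.2 (m + 1) (by simp) t ht

lemma UClass.integrableOn (hu : UClass (m + 1) (Icc a b) u) :
    IntegrableOn (fun t => (-1 : ℝ) ^ m * iteratedDeriv (m + 1) u t) (Ioc a b) :=
  intervalIntegral.integrableOn_deriv_of_nonneg
    (g := fun t => (-1 : ℝ) ^ m * iteratedDeriv m u t)
    (fun t _ => ((hu.hasDerivAt t).const_mul _).continuousAt.continuousWithinAt)
    (fun t _ => (hu.hasDerivAt t).const_mul _) fun _ ht => hu.nonneg (Ioo_subset_Icc_self ht)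

lemma UClass.eq_taylor_sum_sub (hu : UClass (m + 1) (Icc a b) u) {x : ℝ} (hx : x ∈ Icc a b) :
    u x = (∑ k ∈ Finset.range (m + 1), iteratedDeriv k u b / (k.factorial : ℝ) * (x - b) ^ k)
      - (∫ t in Ioc a b, (-1 : ℝ) ^ m * iteratedDeriv (m + 1) u t * momFn (m + 1) t x)
        / (m.factorial : ℝ) := by
  have hd := hasDerivAt_taylor_sum hu.1 x
  have hrew : ∀ t, iteratedDeriv (m + 1) u t / (m.factorial : ℝ) * (x - t) ^ m =
      (-1 : ℝ) ^ m * iteratedDeriv (m + 1) u t * (t - x) ^ m / (m.factorial : ℝ) := fun t => by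
    rw [← neg_sub t x, neg_pow]
    ring
  simp_rw [hrew] at hd
  have hint : IntervalIntegrable (fun t => (-1 : ℝ) ^ m * iteratedDeriv (m + 1) u t *
      (t - x) ^ m / (m.factorial : ℝ)) volume x b := by
    refine intervalIntegral.intervalIntegrable_deriv_of_nonneg
      (fun t _ => (hd t).continuousAt.continuousWithinAt) (fun t _ => hd t) fun t ht => ?_
    rw [min_eq_left hx.2, max_eq_right hx.2] at ht
    have h1 := hu.nonneg (t := t) ⟨hx.1.trans ht.1.le, ht.2.le⟩
    have h2 : 0 ≤ t - x := sub_nonneg.2 ht.1.le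
    positivity
  have hftc := intervalIntegral.integral_eq_sub_of_hasDerivAt (fun t _ => hd t) hint
  have hx0 : (∑ k ∈ Finset.range (m + 1),
      iteratedDeriv k u x / (k.factorial : ℝ) * (x - x) ^ k) = u x := by
    rw [Finset.sum_range_succ']
    simp
  have hker : (∫ t in Ioc a b, (-1 : ℝ) ^ m * iteratedDeriv (m + 1) u t * momFn (m + 1) t x) =
      ∫ t in x..b, (-1 : ℝ) ^ m * iteratedDeriv (m + 1) u t * (t - x) ^ m := by
    rw [intervalIntegral.integral_of_le hx.2, ← integral_Icc_eq_integral_Ioc,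
      ← integral_Icc_eq_integral_Ioc]
    have hsub : Icc x b ⊆ Icc a b := Icc_subset_Icc_left hx.1
    refine (setIntegral_eq_of_subset_of_forall_sdiff_eq_zero measurableSet_Icc hsub ?_).trans
      (setIntegral_congr_fun measurableSet_Icc fun t ht => ?_)
    · intro t ht
      have : t < x := by
        by_contra! hle
        exact ht.2 ⟨hle, ht.1.2⟩
      rw [momFn_of_lt (by omega) this, mul_zero]
    · simp only [momFn_of_le ht.1, Nat.add_sub_cancel]
  rw [intervalIntegral.integral_div, hx0] at hftc
  rw [hker]
  linarith

end Taylor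

section Expectation

variable {Ω : Type*} [MeasurableSpace Ω] {μ : Measure Ω} [IsProbabilityMeasure μ]
  {u : ℝ → ℝ} {m : ℕ} {a b : ℝ} {X : Ω → ℝ}

lemma integrable_prod_mul_momFn {v : ℝ → ℝ} (hv : IntegrableOn v (Ioc a b))
    (hX : Measurable X) (hXa : ∀ ω, a ≤ X ω) :
    Integrable (fun p : ℝ × Ω => v p.1 * momFn (m + 1) p.1 (X p.2))
      ((volume.restrict (Ioc a b)).prod μ) := by
  refine (Integrable.comp_fst hv μ).mul_bdd (c := |b - a| ^ m)
    ((measurable_momFn_uncurry (m + 1)).comp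
      (measurable_fst.prodMk (hX.comp measurable_snd))).aestronglyMeasurable ?_
  have hmem : ∀ᵐ t ∂volume.restrict (Ioc a b), t ∈ Ioc a b := ae_restrict_mem measurableSet_Ioc
  filter_upwards [Measure.quasiMeasurePreserving_fst.ae hmem] with p hp
  exact norm_momFn_le (by omega) (hXa p.2) (abs_nonneg _)
    (le_trans (by linarith [hp.2]) (le_abs_self _))

lemma UClass.integral_comp_eq (hu : UClass (m + 1) (Icc a b) u)
    (hX : Measurable X) (hXab : ∀ ω, X ω ∈ Icc a b) :
    ∫ ω, u (X ω) ∂μ =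
      (∑ k ∈ Finset.range (m + 1),
        iteratedDeriv k u b / (k.factorial : ℝ) * ((-1) ^ k * ∫ ω, (b - X ω) ^ k ∂μ))
      - (∫ t in Ioc a b, (-1 : ℝ) ^ m * iteratedDeriv (m + 1) u t *
          ∫ ω, momFn (m + 1) t (X ω) ∂μ) / (m.factorial : ℝ) := by
  have hprod := integrable_prod_mul_momFn (μ := μ) (m := m) hu.integrableOn hX fun ω => (hXab ω).1
  have hsum : ∀ k ∈ Finset.range (m + 1), Integrable
      (fun ω => iteratedDeriv k u b / (k.factorial : ℝ) * (X ω - b) ^ k) μ := fun k _ =>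
    integrable_comp_of_mem_Icc hX hXab
      (f := fun x => iteratedDeriv k u b / (k.factorial : ℝ) * (x - b) ^ k) (by fun_prop)
  rw [integral_congr_ae (Eventually.of_forall fun ω => hu.eq_taylor_sum_sub (hXab ω)),
    integral_sub (integrable_finsetSum _ hsum) (hprod.integral_prod_right.div_const _),
    integral_finsetSum _ hsum, integral_div,
    ← integral_integral_swap hprod]
  simp_rw [integral_const_mul]
  congr 1
  refine Finset.sum_congr rfl fun k _ => ?_
  congr 1
  rw [← integral_const_mul]
  simp_rw [← mul_pow, neg_one_mul, neg_sub]

end Expectation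

theorem stmt_1 {Ω : Type*} [MeasurableSpace Ω] (μ : Measure Ω) [IsProbabilityMeasure μ]
    (a b : ℝ) (hab : a < b) (n : ℕ) (hn : 1 ≤ n)
    (X Y : Ω → ℝ) (hX : Measurable X) (hY : Measurable Y)
    (hXab : ∀ ω, X ω ∈ Set.Icc a b) (hYab : ∀ ω, Y ω ∈ Set.Icc a b) :
    SDI μ X Y n a b ↔
      ∀ u : ℝ → ℝ, UClass n (Set.Icc a b) u →
        (∫ ω, u (Y ω) ∂μ) ≤ ∫ ω, u (X ω) ∂μ := by
  obtain ⟨m, rfl⟩ := Nat.exists_eq_add_of_le' hn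
  constructor
  · rintro ⟨hker, hmom⟩ u hu
    rw [hu.integral_comp_eq hX hXab, hu.integral_comp_eq hY hYab]
    refine sub_le_sub (Finset.sum_le_sum fun k hk => ?_)
      (div_le_div_of_nonneg_right ?_ (by positivity))
    · rcases Nat.eq_zero_or_pos k with rfl | hk0
      · simp
      have hk' := Finset.mem_range.1 hk
      have h1 := hmom (k + 1) (by simp; omega)
      have h2 := hu.2 k (Finset.mem_Icc.2 ⟨hk0, hk'.le⟩) b (right_mem_Icc.2 hab.le)
      obtain ⟨j, rfl⟩ := Nat.exists_eq_add_of_le' hk0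
      simp only [Nat.add_sub_cancel] at h1 h2
      have h3 := mul_le_mul_of_nonneg_left h1
        (div_nonneg h2 (Nat.cast_nonneg (j + 1).factorial))
      rw [pow_succ (-1 : ℝ) j]
      linear_combination h3
    · refine setIntegral_mono_on ?_ ?_ measurableSet_Ioc fun t ht => ?_
      · have := (integrable_prod_mul_momFn (μ := μ) (m := m) hu.integrableOn hX
          fun ω => (hXab ω).1).integral_prod_left
        simpa only [integral_const_mul] using! this
      · have := (integrable_prod_mul_momFn (μ := μ) (m := m) hu.integrableOn hY
          fun ω => (hYab ω).1).integral_prod_left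
        simpa only [integral_const_mul] using! this
      · have ht' := Ioc_subset_Icc_self ht
        exact mul_le_mul_of_nonneg_left (hker t ht') (hu.nonneg ht')
  · intro H
    refine ⟨fun η _ => ?_, fun k _ => ?_⟩
    · have hlim : Tendsto (fun j : ℕ => 2 * (1 / ((j : ℝ) + 1))) atTop (nhds 0) := by
        simpa using tendsto_one_div_add_atTop_nhds_zero_nat (𝕜 := ℝ) |>.const_mul 2
      refine ge_of_tendsto' (tendsto_integral_momFn hn hY (fun ω => (hYab ω).1) η
        (fun j => by positivity) (c := 2) (fun j => ?_) hlim) fun j => ?_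
      · have : 1 / ((j : ℝ) + 1) ≤ 1 := by
          rw [div_le_one (by positivity)]
          linarith [(Nat.cast_nonneg j : (0 : ℝ) ≤ j)]
        linarith
      · set h : ℝ := 1 / ((j : ℝ) + 1)
        have hh : 0 < h := by positivity
        have hu := H _ (uClass_neg_posPartSecondDiff m (Icc a b) hh.le η)
        rw [integral_neg, integral_neg, neg_le_neg_iff] at hu
        have hc : Continuous fun x => posPartSecondDiff (m + 2) h (η - x) :=
          (continuous_posPartSecondDiff (m + 2) h).comp (by fun_prop)
        have hpos : (0 : ℝ) < (m + 2) * (m + 1) * h ^ 2 := by positivity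
        refine le_of_mul_le_mul_left ?_ hpos
        rw [← integral_const_mul, ← integral_const_mul]
        refine (integral_mono ((integrable_momFn_comp hn hX (fun ω => (hXab ω).1) η).const_mul _)
          (integrable_comp_of_mem_Icc hX hXab hc) fun ω => ?_).trans (hu.trans
          (integral_mono (integrable_comp_of_mem_Icc hY hYab hc)
            ((integrable_momFn_comp hn hY (fun ω => (hYab ω).1) _).const_mul _) fun ω => ?_))
        · rw [momFn_eq_sub]
          exact mul_momFn_le_posPartSecondDiff m hh _
        · rw [momFn_eq_sub, show η + 2 * h - Y ω = η - Y ω + 2 * h by ring]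
          exact posPartSecondDiff_le_mul_momFn m hh _
    · have hu := H _ (uClass_neg_pow (m + 1) (k - 1) a b)
      rwa [integral_neg, integral_neg, neg_le_neg_iff] at hu
end

section
/- Let X be a random variable with P(X = 2/9) = 809/900 and P(X = 1) = 91/900, and let Y be a random variable with P(Y = 0) = 1/3 and P(Y = 4/9) = 2/3. Then X dominates Y in fourth-order stochastic dominance on [0,2]; in particular E[(2−X)] − E[(2−Y)] = −37/8100 < 0 and E[(2−X)²] − E[(2−Y)²] = −13/2916 < 0. -/
open MeasureTheory Filter Set

/-- The expectation of a function of a random variable that takes only two values. -/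
theorem integral_comp_of_two_values {Ω : Type*} [MeasurableSpace Ω] {μ : Measure Ω}
    [IsProbabilityMeasure μ] {X : Ω → ℝ} (hX : Measurable X) {a b p q : ℝ} (hab : a ≠ b)
    (ha : μ.real {ω | X ω = a} = p) (hb : μ.real {ω | X ω = b} = q) (hpq : p + q = 1)
    (f : ℝ → ℝ) : ∫ ω, f (X ω) ∂μ = p * f a + q * f b := by
  have hA : MeasurableSet {ω | X ω = a} := hX (measurableSet_singleton a)
  have hB : MeasurableSet {ω | X ω = b} := hX (measurableSet_singleton b)
  have hdisj : Disjoint {ω | X ω = a} {ω | X ω = b} :=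
    Set.disjoint_left.2 fun ω h h' => hab (h.symm.trans h')
  have hunion : μ.real ({ω | X ω = a} ∪ {ω | X ω = b}) = 1 := by
    rw [measureReal_union hdisj hB, ha, hb, hpq]
  have hae : ∀ᵐ ω ∂μ, ω ∈ {ω | X ω = a} ∪ {ω | X ω = b} := by
    refine (mem_ae_iff_prob_eq_one (hA.union hB)).2 ?_
    simpa [measureReal_def, ENNReal.toReal_eq_one_iff] using hunion
  have hfX : (fun ω => f (X ω)) =ᵐ[μ] fun ω =>
      {ω | X ω = a}.indicator (fun _ => f a) ω + {ω | X ω = b}.indicator (fun _ => f b) ω := by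
    filter_upwards [hae] with ω hω
    rcases hω with h | h
    · have h : X ω = a := h
      simp [Set.indicator, h, hab]
    · have h : X ω = b := h
      simp [Set.indicator, h, hab.symm]
  rw [integral_congr_ae hfX, integral_add ((integrable_const _).indicator hA)
    ((integrable_const _).indicator hB), integral_indicator_const _ hA,
    integral_indicator_const _ hB, ha, hb, smul_eq_mul, smul_eq_mul]

/-- The third-order lower partial moments of the two distributions are ordered. -/
theorem cubic_lower_partial_moment_le {η : ℝ} (h0 : 0 ≤ η) (h2 : η ≤ 2) :
    809 / 900 * max (η - 2 / 9) 0 ^ 3 + 91 / 900 * max (η - 1) 0 ^ 3 ≤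
      1 / 3 * max (η - 0) 0 ^ 3 + 2 / 3 * max (η - 4 / 9) 0 ^ 3 := by
  rw [sub_zero, max_eq_left h0]
  rcases le_total η (2 / 9) with h | h
  · rw [max_eq_right (by linarith : η - 2 / 9 ≤ 0), max_eq_right (by linarith : η - 1 ≤ 0),
      max_eq_right (by linarith : η - 4 / 9 ≤ 0)]
    have := pow_nonneg h0 3
    linarith
  rw [max_eq_left (by linarith : 0 ≤ η - 2 / 9)]
  rcases le_total η (4 / 9) with h' | h'
  · rw [max_eq_right (by linarith : η - 1 ≤ 0), max_eq_right (by linarith : η - 4 / 9 ≤ 0)]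
    have : (η - 2 / 9) ^ 3 ≤ (η / 2) ^ 3 := pow_le_pow_left₀ (by linarith) (by linarith) 3
    have := pow_nonneg h0 3
    linarith
  rw [max_eq_left (by linarith : 0 ≤ η - 4 / 9)]
  rcases le_total η 1 with h1 | h1
  · rw [max_eq_right (by linarith : η - 1 ≤ 0)]
    nlinarith [mul_nonneg h0 (sq_nonneg (η - 2 / 3)), sq_nonneg (η - 2 / 3)]
  · rw [max_eq_left (by linarith : 0 ≤ η - 1)]
    nlinarith [mul_nonneg (sub_nonneg.2 h1) (sub_nonneg.2 h2)]

theorem stmt_7 {Ω : Type*} [MeasurableSpace Ω] (μ : Measure Ω) [IsProbabilityMeasure μ]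
    (X Y : Ω → ℝ) (hX : Measurable X) (hY : Measurable Y)
    (hX1 : μ {ω | X ω = 2 / 9} = 809 / 900) (hX2 : μ {ω | X ω = 1} = 91 / 900)
    (hY1 : μ {ω | Y ω = 0} = 1 / 3) (hY2 : μ {ω | Y ω = 4 / 9} = 2 / 3) :
    SDI μ X Y 4 0 2 ∧
    ((∫ ω, (2 - X ω) ∂μ) - ∫ ω, (2 - Y ω) ∂μ) = -(37 / 8100) ∧
    ((∫ ω, (2 - X ω) ^ 2 ∂μ) - ∫ ω, (2 - Y ω) ^ 2 ∂μ) = -(13 / 2916) := by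
  have toReal {s : Set Ω} {m n : ℕ} (h : μ s = m / n) : μ.real s = m / n := by
    simp [measureReal_def, h]
  have eX := integral_comp_of_two_values hX (a := 2 / 9) (b := 1) (by norm_num)
    (toReal (m := 809) (n := 900) (by simpa using hX1))
    (toReal (m := 91) (n := 900) (by simpa using hX2)) (by norm_num)
  have eY := integral_comp_of_two_values hY (a := 0) (b := 4 / 9) (by norm_num)
    (toReal (m := 1) (n := 3) (by simpa using hY1))
    (toReal (m := 2) (n := 3) (by simpa using hY2)) (by norm_num)
  push_cast at eX eY
  refine ⟨⟨fun η hη => ?_, fun k hk => ?_⟩, ?_, ?_⟩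
  · rw [eX (momFn 4 η), eY (momFn 4 η)]
    simpa [momFn] using cubic_lower_partial_moment_le hη.1 hη.2
  · rw [eX fun x => (2 - x) ^ (k - 1), eY fun x => (2 - x) ^ (k - 1)]
    fin_cases hk <;> norm_num
  · rw [eX fun x => 2 - x, eY fun x => 2 - x]
    norm_num
  · rw [eX fun x => (2 - x) ^ 2, eY fun x => (2 - x) ^ 2]
    norm_num
end
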